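/- Let μ > 1 and let g ∈ C_2(V) be such that ‖δg‖_μ < ∞. Then there exist f ∈ C_1(V) and R ∈ C_2(V) with ‖R‖_μ < ∞ such that g = δf + R (so that δR = δg). Moreover R is unique among elements of C_2(V) with δR = δg and ‖R‖_ν < ∞ for some ν > 1, and f is unique up to an additive constant. -/

import Mathlib

open scoped BigOperators

universe u

variable {V : Type u}


/-- Membership in `C₂(V)`: 1-increments on `[0,T]²` vanish on the diagonal. -/
def MemC2 (T : ℝ) [Zero V] (g : ℝ → ℝ → V) : Prop :=
  ∀ t ∈ Set.Icc (0 : ℝ) T, g t t = 0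

/-- Membership in `C₃(V)`: 2-increments vanish when two consecutive arguments coincide. -/
def MemC3 (T : ℝ) [Zero V] (h : ℝ → ℝ → ℝ → V) : Prop :=
  ∀ t ∈ Set.Icc (0 : ℝ) T, ∀ u ∈ Set.Icc (0 : ℝ) T, ∀ s ∈ Set.Icc (0 : ℝ) T,
    t = u ∨ u = s → h t u s = 0

/-- `(δg)_{tus} = g_{ts} − g_{tu} − g_{us}`. -/
def delta2 [AddCommGroup V] (g : ℝ → ℝ → V) : ℝ → ℝ → ℝ → V :=
  fun t u s => g t s - g t u - g u s

/-- `δh = 0` on `[0,T]⁴` for a 2-increment `h`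
(`(δh)(t,u,v,s) = −h(u,v,s) + h(t,v,s) − h(t,u,s) + h(t,u,v)`). -/
def ZD3 (T : ℝ) [AddCommGroup V] (h : ℝ → ℝ → ℝ → V) : Prop :=
  ∀ t ∈ Set.Icc (0 : ℝ) T, ∀ u ∈ Set.Icc (0 : ℝ) T, ∀ v ∈ Set.Icc (0 : ℝ) T,
    ∀ s ∈ Set.Icc (0 : ℝ) T, h u v s - h t v s + h t u s - h t u v = 0

/-- `h = Σᵢ hᵢ` on `[0,T]³` with `hᵢ ∈ C₃(V)` and
`‖hᵢ(t,u,s)‖ ≤ Kᵢ |u−s|^{ρᵢ} |t−u|^{μ−ρᵢ}`, `ρᵢ ∈ (0,μ)`; witnessing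
`‖h‖_μ ≤ Σᵢ Kᵢ` for the norm of Section 2.1. -/
def DecompBound (T μ : ℝ) [NormedAddCommGroup V] (h : ℝ → ℝ → ℝ → V)
    (n : ℕ) (hs : Fin n → ℝ → ℝ → ℝ → V) (ρ K : Fin n → ℝ) : Prop :=
  (∀ i, ρ i ∈ Set.Ioo 0 μ) ∧ (∀ i, 0 ≤ K i) ∧ (∀ i, MemC3 T (hs i)) ∧
  (∀ t ∈ Set.Icc (0 : ℝ) T, ∀ u ∈ Set.Icc (0 : ℝ) T, ∀ s ∈ Set.Icc (0 : ℝ) T,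
    h t u s = ∑ i, hs i t u s) ∧
  ∀ i, ∀ t ∈ Set.Icc (0 : ℝ) T, ∀ u ∈ Set.Icc (0 : ℝ) T, ∀ s ∈ Set.Icc (0 : ℝ) T,
    ‖hs i t u s‖ ≤ K i * |u - s| ^ ρ i * |t - u| ^ (μ - ρ i)

/-- Membership in `C₂^{1+}(V)`: Hölder regularity of order `ν` for some `ν > 1`. -/
def C2plus (T : ℝ) [NormedAddCommGroup V] (g : ℝ → ℝ → V) : Prop :=
  ∃ ν : ℝ, 1 < ν ∧ ∃ K : ℝ, 0 ≤ K ∧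
    ∀ t ∈ Set.Icc (0 : ℝ) T, ∀ s ∈ Set.Icc (0 : ℝ) T, ‖g t s‖ ≤ K * |t - s| ^ ν

/-- Membership in `ZC₃^{1+}(V) = ∪_{μ>1} ZC₃^μ(V)`. -/
def ZC1p (T : ℝ) [NormedAddCommGroup V] (h : ℝ → ℝ → ℝ → V) : Prop :=
  MemC3 T h ∧ ZD3 T h ∧ ∃ μ : ℝ, 1 < μ ∧ ∃ n hs ρ K, DecompBound T μ h n hs ρ K

/-- Grid width. -/
noncomputable def sewH (T : ℝ) (n : ℕ) : ℝ := T * (1 / 2) ^ n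

/-- Index of the cell containing `t`. -/
noncomputable def sewN (T : ℝ) (n : ℕ) (t : ℝ) : ℕ := ⌊t / sewH T n⌋₊

/-- Riemann sums along the grid, with end correction. -/
noncomputable def sewF [AddCommGroup V] (T : ℝ) (g : ℝ → ℝ → V) (n : ℕ) (t : ℝ) : V :=
  (∑ k ∈ Finset.range (sewN T n t), g (((k : ℝ) + 1) * sewH T n) ((k : ℝ) * sewH T n))
    + g t ((sewN T n t : ℝ) * sewH T n)

theorem sewH_pos {T : ℝ} (hT : 0 < T) (n : ℕ) : 0 < sewH T n := by
  unfold sewH; positivity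

theorem sewH_succ (T : ℝ) (n : ℕ) : sewH T n = 2 * sewH T (n + 1) := by
  unfold sewH; rw [pow_succ]; ring

theorem sewN_le {T : ℝ} (hT : 0 < T) (n : ℕ) {t : ℝ} (ht : 0 ≤ t) :
    (sewN T n t : ℝ) * sewH T n ≤ t := by
  have h := sewH_pos hT n
  rw [← le_div_iff₀ h]
  exact Nat.floor_le (by positivity)

theorem sewN_lt {T : ℝ} (hT : 0 < T) (n : ℕ) (t : ℝ) :
    t < ((sewN T n t : ℝ) + 1) * sewH T n := by
  have h := sewH_pos hT n
  rw [← div_lt_iff₀ h]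
  exact Nat.lt_floor_add_one _

theorem sewN_succ {T : ℝ} (hT : 0 < T) (n : ℕ) {t : ℝ} (ht : 0 ≤ t) :
    sewN T (n + 1) t = 2 * sewN T n t ∨ sewN T (n + 1) t = 2 * sewN T n t + 1 := by
  have h := sewH_pos hT (n + 1)
  have a1 := sewN_le hT n ht
  have a2 := sewN_lt hT n t
  have b1 := sewN_le hT (n + 1) ht
  have b2 := sewN_lt hT (n + 1) t
  rw [sewH_succ] at a1 a2
  have c1 : (2 * sewN T n t : ℝ) < sewN T (n + 1) t + 1 := by
    by_contra hc
    push Not at hc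
    nlinarith
  have c2 : (sewN T (n + 1) t : ℝ) < 2 * sewN T n t + 2 := by
    by_contra hc
    push Not at hc
    nlinarith
  have d1 : 2 * sewN T n t < sewN T (n + 1) t + 1 := by exact_mod_cast c1
  have d2 : sewN T (n + 1) t < 2 * sewN T n t + 2 := by exact_mod_cast c2
  omega

theorem sew_sum_double [AddCommGroup V] (a : ℕ → V) (N : ℕ) :
    ∑ k ∈ Finset.range (2 * N), a k = ∑ k ∈ Finset.range N, (a (2 * k) + a (2 * k + 1)) := by
  induction N with
  | zero => simp
  | succ N ih =>
    rw [Finset.sum_range_succ, ← ih, show 2 * (N + 1) = 2 * N + 1 + 1 by ring,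
      Finset.sum_range_succ, Finset.sum_range_succ]
    abel

theorem sewF_succ [AddCommGroup V] {T : ℝ} (hT : 0 < T) {g : ℝ → ℝ → V} (hg : MemC2 T g)
    (n : ℕ) {t : ℝ} (ht : t ∈ Set.Icc (0 : ℝ) T) :
    sewF T g (n + 1) t = sewF T g n t
      - ∑ k ∈ Finset.range (sewN T n t), delta2 g (((k : ℝ) + 1) * sewH T n)
          (((k : ℝ) + 1 / 2) * sewH T n) ((k : ℝ) * sewH T n)
      - delta2 g t ((sewN T (n + 1) t : ℝ) * sewH T (n + 1)) ((sewN T n t : ℝ) * sewH T n) := by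
  have hh := sewH_pos hT (n + 1)
  have e1 : ∑ k ∈ Finset.range (2 * sewN T n t),
      g (((k : ℝ) + 1) * sewH T (n + 1)) ((k : ℝ) * sewH T (n + 1))
      = (∑ k ∈ Finset.range (sewN T n t), g (((k : ℝ) + 1) * sewH T n) ((k : ℝ) * sewH T n))
      - ∑ k ∈ Finset.range (sewN T n t), delta2 g (((k : ℝ) + 1) * sewH T n)
          (((k : ℝ) + 1 / 2) * sewH T n) ((k : ℝ) * sewH T n) := by
    rw [sew_sum_double (fun k : ℕ => g (((k : ℝ) + 1) * sewH T (n + 1)) ((k : ℝ) * sewH T (n + 1))),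
      ← Finset.sum_sub_distrib]
    refine Finset.sum_congr rfl fun k _ => ?_
    simp only [delta2]
    rw [sewH_succ T n]
    push_cast
    rw [show (2 * (k : ℝ) + 1 + 1) * sewH T (n + 1) = ((k : ℝ) + 1) * (2 * sewH T (n + 1)) by ring,
      show (2 * (k : ℝ) + 1) * sewH T (n + 1) = ((k : ℝ) + 1 / 2) * (2 * sewH T (n + 1)) by ring,
      show (2 * (k : ℝ)) * sewH T (n + 1) = (k : ℝ) * (2 * sewH T (n + 1)) by ring]
    abel
  have hle := sewN_le hT n ht.1
  have hp : g ((sewN T n t : ℝ) * sewH T n) ((sewN T n t : ℝ) * sewH T n) = 0 :=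
    hg _ ⟨by have := sewH_pos hT n; positivity, hle.trans ht.2⟩
  have e3 : ((2 * sewN T n t : ℕ) : ℝ) * sewH T (n + 1) = (sewN T n t : ℝ) * sewH T n := by
    rw [sewH_succ T n]; push_cast; ring
  rcases sewN_succ hT n ht.1 with h | h
  · unfold sewF
    rw [h, e1, e3]
    simp only [delta2, hp]
    abel
  · unfold sewF
    rw [h, Finset.sum_range_succ, e1, e3]
    simp only [delta2]
    push_cast
    abel

theorem sewN_diff {T : ℝ} (hT : 0 < T) (n j : ℕ) {s t : ℝ} (hs : 0 ≤ s) (hst : s ≤ t)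
    (hd : t - s ≤ sewH T n) :
    sewN T (n + j) s ≤ sewN T (n + j) t ∧
      (sewN T (n + j) t : ℝ) ≤ sewN T (n + j) s + (2 : ℝ) ^ j + 1 := by
  have h := sewH_pos hT (n + j)
  constructor
  · unfold sewN
    gcongr
  · have e : sewH T n = 2 ^ j * sewH T (n + j) := by
      unfold sewH
      rw [pow_add, show (2 : ℝ) ^ j * (T * ((1 / 2) ^ n * (1 / 2) ^ j))
        = T * (1 / 2) ^ n * (2 * (1 / 2)) ^ j by rw [mul_pow]; ring]
      norm_num
    have a := sewN_le hT (n + j) (hs.trans hst)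
    have b := sewN_lt hT (n + j) s
    by_contra hc
    push Not at hc
    nlinarith

theorem sew_step [NormedAddCommGroup V] {T μ M : ℝ} (hT : 0 < T) (hM : 0 ≤ M)
    {g : ℝ → ℝ → V} (hg : MemC2 T g)
    (hb : ∀ D : ℝ, 0 ≤ D → ∀ t ∈ Set.Icc (0 : ℝ) T, ∀ u ∈ Set.Icc (0 : ℝ) T,
      ∀ s ∈ Set.Icc (0 : ℝ) T, |u - s| ≤ D → |t - u| ≤ D → ‖delta2 g t u s‖ ≤ M * D ^ μ)
    (n j : ℕ) {s t : ℝ} (hs : s ∈ Set.Icc (0 : ℝ) T) (ht : t ∈ Set.Icc (0 : ℝ) T) (hst : s ≤ t)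
    (hd : t - s ≤ sewH T n) :
    dist (sewF T g (n + j) t - sewF T g (n + j) s)
      (sewF T g (n + (j + 1)) t - sewF T g (n + (j + 1)) s)
      ≤ (4 * M * sewH T n ^ μ) * (2 * (1 / 2 : ℝ) ^ μ) ^ j := by
  have hh := sewH_pos hT (n + j)
  obtain ⟨hN1, hN2⟩ := sewN_diff hT n j hs.1 hst hd
  have he : ∀ t ∈ Set.Icc (0 : ℝ) T, ‖delta2 g t ((sewN T (n + j + 1) t : ℝ) * sewH T (n + j + 1))
      ((sewN T (n + j) t : ℝ) * sewH T (n + j))‖ ≤ M * sewH T (n + j) ^ μ := by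
    intro t ht
    have a1 := sewN_le hT (n + j) ht.1
    have a2 := sewN_lt hT (n + j) t
    have b1 := sewN_le hT (n + j + 1) ht.1
    have b2 := sewN_lt hT (n + j + 1) t
    have hh' := sewH_pos hT (n + j + 1)
    have hr := sewH_succ T (n + j)
    have c : (sewN T (n + j) t : ℝ) * sewH T (n + j)
        ≤ (sewN T (n + j + 1) t : ℝ) * sewH T (n + j + 1) := by
      have : (2 * sewN T (n + j) t : ℝ) ≤ sewN T (n + j + 1) t := by
        rcases sewN_succ hT (n + j) ht.1 with h | h <;> rw [h] <;> push_cast <;> linarith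
      rw [hr]
      nlinarith
    refine hb _ hh.le _ ht _ ⟨by positivity, b1.trans ht.2⟩ _ ⟨by positivity, a1.trans ht.2⟩ ?_ ?_
    · rw [abs_le]; constructor <;> linarith
    · rw [abs_le]; constructor <;> linarith
  have hk : ∀ k ∈ Finset.Ico (sewN T (n + j) s) (sewN T (n + j) t),
      ‖delta2 g (((k : ℝ) + 1) * sewH T (n + j))
          (((k : ℝ) + 1 / 2) * sewH T (n + j)) ((k : ℝ) * sewH T (n + j))‖
        ≤ M * sewH T (n + j) ^ μ := by
    intro k hk
    have hk2 : ((k : ℝ) + 1) ≤ sewN T (n + j) t := by exact_mod_cast (Finset.mem_Ico.1 hk).2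
    have a1 := sewN_le hT (n + j) ht.1
    have a3 : ((k : ℝ) + 1) * sewH T (n + j) ≤ T := by nlinarith [ht.2]
    refine hb _ hh.le _ ⟨by positivity, a3⟩ _ ⟨by positivity, by nlinarith⟩ _
      ⟨by positivity, by nlinarith⟩ ?_ ?_
    · rw [abs_le]; constructor <;> linarith
    · rw [abs_le]; constructor <;> linarith
  have hsum := Finset.sum_Ico_eq_sub (fun k : ℕ => delta2 g (((k : ℝ) + 1) * sewH T (n + j))
          (((k : ℝ) + 1 / 2) * sewH T (n + j)) ((k : ℝ) * sewH T (n + j))) hN1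
  have hS := norm_sum_le_of_le _ hk
  rw [Finset.sum_const, Nat.card_Ico, nsmul_eq_mul, Nat.cast_sub hN1, hsum] at hS
  have et := he t ht
  have es := he s hs
  rw [← add_assoc, sewF_succ hT hg (n + j) ht, sewF_succ hT hg (n + j) hs, dist_eq_norm]
  have hpow : sewH T (n + j) ^ μ * 2 ^ j = sewH T n ^ μ * (2 * (1 / 2 : ℝ) ^ μ) ^ j := by
    have : sewH T (n + j) = sewH T n * (1 / 2) ^ j := by unfold sewH; rw [pow_add]; ring
    rw [this, Real.mul_rpow (sewH_pos hT n).le (by positivity), mul_pow,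
      ← Real.rpow_natCast_mul (by norm_num), ← Real.rpow_mul_natCast (by norm_num),
      mul_comm (j : ℝ) μ]
    ring
  have h2 : (1 : ℝ) ≤ 2 ^ j := one_le_pow₀ (by norm_num)
  have hX : 0 ≤ M * sewH T (n + j) ^ μ := by positivity
  rw [mul_assoc (4 * M), ← hpow]
  generalize sewF T g (n + j) t = A, sewF T g (n + j) s = B,
    delta2 g t ((sewN T (n + j + 1) t : ℝ) * sewH T (n + j + 1))
      ((sewN T (n + j) t : ℝ) * sewH T (n + j)) = Et,
    delta2 g s ((sewN T (n + j + 1) s : ℝ) * sewH T (n + j + 1))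
      ((sewN T (n + j) s : ℝ) * sewH T (n + j)) = Es at et es ⊢
  generalize (∑ k ∈ Finset.range (sewN T (n + j) t), delta2 g (((k : ℝ) + 1) * sewH T (n + j))
          (((k : ℝ) + 1 / 2) * sewH T (n + j)) ((k : ℝ) * sewH T (n + j))) = St,
    (∑ k ∈ Finset.range (sewN T (n + j) s), delta2 g (((k : ℝ) + 1) * sewH T (n + j))
          (((k : ℝ) + 1 / 2) * sewH T (n + j)) ((k : ℝ) * sewH T (n + j))) = Ss at hS ⊢
  have : A - B - (A - St - Et - (B - Ss - Es)) = (St - Ss) + (Et - Es) := by abel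
  rw [this]
  have n1 := norm_add_le (St - Ss) (Et - Es)
  have n2 := norm_sub_le Et Es
  nlinarith

theorem sew_base [NormedAddCommGroup V] {T μ M : ℝ} (hT : 0 < T) (hM : 0 ≤ M)
    {g : ℝ → ℝ → V}
    (hb : ∀ D : ℝ, 0 ≤ D → ∀ t ∈ Set.Icc (0 : ℝ) T, ∀ u ∈ Set.Icc (0 : ℝ) T,
      ∀ s ∈ Set.Icc (0 : ℝ) T, |u - s| ≤ D → |t - u| ≤ D → ‖delta2 g t u s‖ ≤ M * D ^ μ)
    (n : ℕ) {s t : ℝ} (hs : s ∈ Set.Icc (0 : ℝ) T) (ht : t ∈ Set.Icc (0 : ℝ) T) (hst : s ≤ t)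
    (hd : t - s ≤ sewH T n) :
    ‖sewF T g n t - sewF T g n s - g t s‖ ≤ 2 * M * sewH T n ^ μ := by
  have hh := sewH_pos hT n
  have a1 := sewN_le hT n ht.1
  have a2 := sewN_lt hT n t
  have b1 := sewN_le hT n hs.1
  have b2 := sewN_lt hT n s
  have hX : 0 ≤ M * sewH T n ^ μ := by positivity
  have hN : sewN T n s ≤ sewN T n t := by unfold sewN; gcongr
  have hN2 : (sewN T n t : ℝ) < sewN T n s + 2 := by
    by_contra hc
    push Not at hc
    nlinarith
  have hN3 : sewN T n t < sewN T n s + 2 := by exact_mod_cast hN2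
  have hcase : sewN T n t = sewN T n s ∨ sewN T n t = sewN T n s + 1 := by omega
  rcases hcase with h | h
  · have := hb _ hh.le t ht s hs ((sewN T n s : ℝ) * sewH T n) ⟨by positivity, b1.trans hs.2⟩
      (by rw [abs_le]; constructor <;> linarith) (by rw [abs_le]; constructor <;> linarith)
    unfold sewF
    rw [h]
    simp only [delta2] at this
    refine le_trans (le_of_eq ?_) (this.trans (by linarith))
    congr 1
    abel
  · rw [h] at a1 a2
    push_cast at a1 a2
    have hbm : ((sewN T n s : ℝ) + 1) * sewH T n ∈ Set.Icc (0 : ℝ) T :=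
      ⟨by positivity, a1.trans ht.2⟩
    have h1 := hb _ hh.le _ hbm s hs ((sewN T n s : ℝ) * sewH T n) ⟨by positivity, b1.trans hs.2⟩
      (by rw [abs_le]; constructor <;> linarith) (by rw [abs_le]; constructor <;> linarith)
    have h2 := hb _ hh.le t ht _ hbm s hs
      (by rw [abs_le]; constructor <;> linarith) (by rw [abs_le]; constructor <;> linarith)
    unfold sewF
    rw [h, Finset.sum_range_succ]
    push_cast
    have h3 := norm_sub_le (delta2 g (((sewN T n s : ℝ) + 1) * sewH T n) s
      ((sewN T n s : ℝ) * sewH T n)) (delta2 g t (((sewN T n s : ℝ) + 1) * sewH T n) s)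
    refine le_trans (le_of_eq ?_) (h3.trans (by linarith))
    congr 1
    simp only [delta2]
    abel

theorem sewF_zero [AddCommGroup V] {T : ℝ} (hT : 0 < T) {g : ℝ → ℝ → V} (hg : MemC2 T g)
    (n : ℕ) : sewF T g n 0 = 0 := by
  have : sewN T n 0 = 0 := by simp [sewN]
  simp [sewF, this, hg 0 ⟨le_rfl, hT.le⟩]

/-- Existence part. -/
theorem sew_exists [NormedAddCommGroup V] [CompleteSpace V] {T μ M : ℝ} (hT : 0 < T)
    (hμ : 1 < μ) (hM : 0 ≤ M) {g : ℝ → ℝ → V} (hg : MemC2 T g)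
    (hb : ∀ D : ℝ, 0 ≤ D → ∀ t ∈ Set.Icc (0 : ℝ) T, ∀ u ∈ Set.Icc (0 : ℝ) T,
      ∀ s ∈ Set.Icc (0 : ℝ) T, |u - s| ≤ D → |t - u| ≤ D → ‖delta2 g t u s‖ ≤ M * D ^ μ) :
    ∃ (f : ℝ → V) (K : ℝ), 0 ≤ K ∧ ∀ t ∈ Set.Icc (0 : ℝ) T, ∀ s ∈ Set.Icc (0 : ℝ) T,
      ‖g t s - (f t - f s)‖ ≤ K * |t - s| ^ μ := by
  set r : ℝ := 2 * (1 / 2 : ℝ) ^ μ with hr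
  have hr1 : r < 1 := by
    have : (1 / 2 : ℝ) ^ μ < (1 / 2 : ℝ) ^ (1 : ℝ) :=
      Real.rpow_lt_rpow_of_exponent_gt (by norm_num) (by norm_num) hμ
    rw [Real.rpow_one] at this
    linarith
  have hlim : ∀ t ∈ Set.Icc (0 : ℝ) T,
      ∃ a, Filter.Tendsto (fun j => sewF T g j t) Filter.atTop (nhds a) := by
    intro t ht
    apply cauchySeq_tendsto_of_complete
    apply cauchySeq_of_le_geometric r (4 * M * sewH T 0 ^ μ) hr1
    intro j
    have := sew_step hT hM hg hb 0 j (s := 0) ⟨le_rfl, hT.le⟩ ht ht.1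
      (by simpa [sewH] using ht.2)
    simp only [sewF_zero hT hg, sub_zero, zero_add] at this
    exact this
  choose! f hf using hlim
  have hKp : 0 ≤ (2 * M + 4 * M / (1 - r)) := by
    have : 0 < 1 - r := by linarith
    positivity
  have main : ∀ t ∈ Set.Icc (0 : ℝ) T, ∀ s ∈ Set.Icc (0 : ℝ) T, s < t →
      ‖g t s - (f t - f s)‖ ≤ ((2 * M + 4 * M / (1 - r)) * 2 ^ μ) * (t - s) ^ μ := by
    intro t ht s hs hst
    obtain ⟨n, hn1, hn2⟩ := exists_nat_pow_near_of_lt_one (x := (t - s) / T) (y := (1 / 2 : ℝ))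
      (div_pos (by linarith) hT) (by rw [div_le_one hT]; linarith [ht.2, hs.1])
      (by norm_num) (by norm_num)
    rw [lt_div_iff₀ hT] at hn1
    rw [div_le_iff₀ hT] at hn2
    have hd : t - s ≤ sewH T n := by unfold sewH; linarith
    have hd2 : sewH T n ≤ 2 * (t - s) := by
      unfold sewH; rw [pow_succ] at hn1; linarith
    have h1 := sew_base hT hM hb n hs ht hst.le hd
    have htend : Filter.Tendsto (fun j => sewF T g (n + j) t - sewF T g (n + j) s)
        Filter.atTop (nhds (f t - f s)) := by
      have hc : Filter.Tendsto (fun j : ℕ => n + j) Filter.atTop Filter.atTop :=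
        Filter.tendsto_atTop_mono (fun j => Nat.le_add_left j n) Filter.tendsto_id
      exact ((hf t ht).comp hc).sub ((hf s hs).comp hc)
    have h2 := dist_le_of_le_geometric_of_tendsto₀ r (4 * M * sewH T n ^ μ) hr1
      (fun j => sew_step hT hM hg hb n j hs ht hst.le hd) htend
    simp only [add_zero] at h2
    rw [dist_eq_norm] at h2
    have h3 : sewH T n ^ μ ≤ 2 ^ μ * (t - s) ^ μ := by
      rw [← Real.mul_rpow (by norm_num) (by linarith)]
      exact Real.rpow_le_rpow (sewH_pos hT n).le hd2 (by linarith)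
    have h4 := norm_sub_le (sewF T g n t - sewF T g n s - (f t - f s))
      (sewF T g n t - sewF T g n s - g t s)
    have h5 : sewF T g n t - sewF T g n s - (f t - f s) - (sewF T g n t - sewF T g n s - g t s)
      = g t s - (f t - f s) := by abel
    rw [h5] at h4
    have h6 := mul_le_mul_of_nonneg_left h3 hKp
    have h7 : 4 * M * sewH T n ^ μ / (1 - r) = 4 * M / (1 - r) * sewH T n ^ μ := by ring
    rw [h7] at h2
    linarith
  refine ⟨f, (2 * M + 4 * M / (1 - r)) * 2 ^ μ + M, by positivity, ?_⟩
  intro t ht s hs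
  have hz : 0 ≤ |t - s| ^ μ := by positivity
  rcases lt_trichotomy s t with h | h | h
  · have := main t ht s hs h
    rw [abs_of_pos (sub_pos.2 h)] at hz ⊢
    nlinarith
  · subst h
    rw [hg s hs]
    simp only [sub_self, norm_zero]
    positivity
  · have h1 := main s hs t ht h
    have h2 := hb |t - s| (abs_nonneg _) t ht s hs t ht (by rw [abs_sub_comm]) le_rfl
    rw [abs_sub_comm, abs_of_pos (sub_pos.2 h)] at h2 ⊢
    have h3 := norm_add_le (delta2 g t s t) (g s t - (f s - f t))
    have h4 : delta2 g t s t + (g s t - (f s - f t)) = - (g t s - (f t - f s)) := by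
      simp only [delta2, hg t ht]; abel
    rw [h4, norm_neg] at h3
    linarith

theorem sew_unique [NormedAddCommGroup V] {T μ ν K L : ℝ} (hμ : 1 < μ) (hν : 1 < ν)
    (a : ℝ → V)
    (h : ∀ t ∈ Set.Icc (0 : ℝ) T, ∀ s ∈ Set.Icc (0 : ℝ) T,
      ‖a t - a s‖ ≤ K * |t - s| ^ μ + L * |t - s| ^ ν) :
    ∀ t ∈ Set.Icc (0 : ℝ) T, ∀ s ∈ Set.Icc (0 : ℝ) T, a t = a s := by
  have key : ∀ n : ℕ, ∀ t ∈ Set.Icc (0 : ℝ) T, ∀ s ∈ Set.Icc (0 : ℝ) T,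
      ‖a t - a s‖ ≤ K * |t - s| ^ μ * (2 * (1 / 2 : ℝ) ^ μ) ^ n
        + L * |t - s| ^ ν * (2 * (1 / 2 : ℝ) ^ ν) ^ n := by
    intro n
    induction n with
    | zero => simpa using h
    | succ n ih =>
      intro t ht s hs
      have hm : (t + s) / 2 ∈ Set.Icc (0 : ℝ) T :=
        ⟨by linarith [ht.1, hs.1], by linarith [ht.2, hs.2]⟩
      have h1 := ih t ht _ hm
      have h2 := ih _ hm s hs
      have e1 : |t - (t + s) / 2| = |t - s| * (1 / 2) := by
        rw [show t - (t + s) / 2 = (t - s) * (1 / 2) by ring, abs_mul]; norm_num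
      have e2 : |(t + s) / 2 - s| = |t - s| * (1 / 2) := by
        rw [show (t + s) / 2 - s = (t - s) * (1 / 2) by ring, abs_mul]; norm_num
      rw [e1, Real.mul_rpow (abs_nonneg _) (by norm_num),
        Real.mul_rpow (abs_nonneg _) (by norm_num)] at h1
      rw [e2, Real.mul_rpow (abs_nonneg _) (by norm_num),
        Real.mul_rpow (abs_nonneg _) (by norm_num)] at h2
      have h3 := norm_add_le (a t - a ((t + s) / 2)) (a ((t + s) / 2) - a s)
      rw [sub_add_sub_cancel] at h3
      refine (h3.trans (add_le_add h1 h2)).trans (le_of_eq ?_)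
      rw [pow_succ, pow_succ]
      ring
  have hr : ∀ μ : ℝ, 1 < μ → Filter.Tendsto (fun n : ℕ => (2 * (1 / 2 : ℝ) ^ μ) ^ n)
      Filter.atTop (nhds 0) := by
    intro μ hμ
    have : (1 / 2 : ℝ) ^ μ < (1 / 2 : ℝ) ^ (1 : ℝ) :=
      Real.rpow_lt_rpow_of_exponent_gt (by norm_num) (by norm_num) hμ
    rw [Real.rpow_one] at this
    exact tendsto_pow_atTop_nhds_zero_of_lt_one (by positivity) (by linarith)
  intro t ht s hs
  have hl := ((hr μ hμ).const_mul (K * |t - s| ^ μ)).add ((hr ν hν).const_mul (L * |t - s| ^ ν))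
  have := ge_of_tendsto' hl (fun n => key n t ht s hs)
  simp only [mul_zero, add_zero] at this
  exact sub_eq_zero.1 (norm_le_zero_iff.1 this)

theorem sew_bound [NormedAddCommGroup V] {T μ : ℝ} (h : ℝ → ℝ → ℝ → V)
    (hdec : ∃ n hs ρ K, DecompBound T μ h n hs ρ K) :
    ∃ M : ℝ, 0 ≤ M ∧ ∀ D : ℝ, 0 ≤ D → ∀ t ∈ Set.Icc (0 : ℝ) T, ∀ u ∈ Set.Icc (0 : ℝ) T,
      ∀ s ∈ Set.Icc (0 : ℝ) T, |u - s| ≤ D → |t - u| ≤ D → ‖h t u s‖ ≤ M * D ^ μ := by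
  obtain ⟨n, hs, ρ, K, hρ, hK, -, hsum, hbd⟩ := hdec
  refine ⟨∑ i, K i, Finset.sum_nonneg fun i _ => hK i, ?_⟩
  intro D hD t ht u hu s hs' h1 h2
  rw [hsum t ht u hu s hs', Finset.sum_mul]
  refine norm_sum_le_of_le _ fun i _ => (hbd i t ht u hu s hs').trans ?_
  have a := (hρ i).1
  have b := (hρ i).2
  have e : D ^ μ = D ^ ρ i * D ^ (μ - ρ i) := by
    rw [← Real.rpow_add_of_nonneg hD a.le (by linarith)]
    congr 1
    ring
  rw [e, ← mul_assoc]
  have k := hK i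
  have c1 : |u - s| ^ ρ i ≤ D ^ ρ i := Real.rpow_le_rpow (abs_nonneg _) h1 a.le
  have c2 : |t - u| ^ (μ - ρ i) ≤ D ^ (μ - ρ i) :=
    Real.rpow_le_rpow (abs_nonneg _) h2 (by linarith)
  gcongr

/-- Canonical decomposition: if `g ∈ C₂(V)` and `‖δg‖_μ < ∞` for some `μ > 1`, then
`g = δf + R` with `f ∈ C₁(V)`, `R ∈ C₂^μ(V)`; `R` is unique among 1-increments with
`δR = δg` lying in `C₂^{1+}(V)`, and `f` is unique up to an additive constant. -/
theorem stmt2 (T : ℝ) (hT : 0 < T) (V : Type u) [NormedAddCommGroup V]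
    [NormedSpace ℝ V] [CompleteSpace V] (μ : ℝ) (hμ : 1 < μ)
    (g : ℝ → ℝ → V) (hg : MemC2 T g)
    (hdec : ∃ n hs ρ K, DecompBound T μ (delta2 g) n hs ρ K) :
    ∃ (f : ℝ → V) (R : ℝ → ℝ → V),
      MemC2 T R ∧
      (∃ K : ℝ, 0 ≤ K ∧ ∀ t ∈ Set.Icc (0 : ℝ) T, ∀ s ∈ Set.Icc (0 : ℝ) T,
        ‖R t s‖ ≤ K * |t - s| ^ μ) ∧
      (∀ t ∈ Set.Icc (0 : ℝ) T, ∀ s ∈ Set.Icc (0 : ℝ) T, g t s = (f t - f s) + R t s) ∧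
      (∀ t ∈ Set.Icc (0 : ℝ) T, ∀ u ∈ Set.Icc (0 : ℝ) T, ∀ s ∈ Set.Icc (0 : ℝ) T,
        delta2 R t u s = delta2 g t u s) ∧
      (∀ R' : ℝ → ℝ → V, MemC2 T R' →
        (∀ t ∈ Set.Icc (0 : ℝ) T, ∀ u ∈ Set.Icc (0 : ℝ) T, ∀ s ∈ Set.Icc (0 : ℝ) T,
          delta2 R' t u s = delta2 g t u s) → C2plus T R' →
        ∀ t ∈ Set.Icc (0 : ℝ) T, ∀ s ∈ Set.Icc (0 : ℝ) T, R' t s = R t s) ∧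
      (∀ (f' : ℝ → V) (R' : ℝ → ℝ → V),
        (∀ t ∈ Set.Icc (0 : ℝ) T, ∀ s ∈ Set.Icc (0 : ℝ) T,
          g t s = (f' t - f' s) + R' t s) → C2plus T R' →
        ∃ c : V, ∀ t ∈ Set.Icc (0 : ℝ) T, f' t = f t + c) := by
  obtain ⟨M, hM, hb⟩ := sew_bound (delta2 g) hdec
  obtain ⟨f, K, hK, hf⟩ := sew_exists hT hμ hM hg hb
  have h0 : (0 : ℝ) ∈ Set.Icc (0 : ℝ) T := ⟨le_rfl, hT.le⟩
  have huniq : ∀ R' : ℝ → ℝ → V, MemC2 T R' →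
        (∀ t ∈ Set.Icc (0 : ℝ) T, ∀ u ∈ Set.Icc (0 : ℝ) T, ∀ s ∈ Set.Icc (0 : ℝ) T,
          delta2 R' t u s = delta2 g t u s) → C2plus T R' →
        ∀ t ∈ Set.Icc (0 : ℝ) T, ∀ s ∈ Set.Icc (0 : ℝ) T, R' t s = g t s - (f t - f s) := by
    rintro R' hR' hδ ⟨ν, hν, L, hL, hRb⟩
    have hadd : ∀ t ∈ Set.Icc (0 : ℝ) T, ∀ s ∈ Set.Icc (0 : ℝ) T,
        (g t 0 - (f t - f 0) - R' t 0) - (g s 0 - (f s - f 0) - R' s 0)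
          = (g t s - (f t - f s)) - R' t s := by
      intro t ht s hs
      have := hδ t ht s hs 0 h0
      simp only [delta2] at this
      have e : R' t 0 = g t 0 - g t s - g s 0 + R' t s + R' s 0 := by rw [← this]; abel
      rw [e]; abel
    intro t ht s hs
    have hc := sew_unique (T := T) hμ hν (K := K) (L := L)
      (fun t => g t 0 - (f t - f 0) - R' t 0) (by
        intro t ht s hs
        simp only [hadd t ht s hs]
        exact (norm_sub_le _ _).trans (add_le_add (hf t ht s hs) (hRb t ht s hs))) t ht s hs
    have h1 := hadd t ht s hs
    rw [sub_eq_zero.2 hc] at h1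
    exact (sub_eq_zero.1 h1.symm).symm
  refine ⟨f, fun t s => g t s - (f t - f s), ?_, ⟨K, hK, hf⟩, ?_, ?_, huniq, ?_⟩
  · intro t ht
    simp [hg t ht]
  · intro t _ s _
    exact (add_sub_cancel _ _).symm
  · intro t _ u _ s _
    simp only [delta2]
    abel
  · intro f' R' hgf hR'
    have hm : MemC2 T R' := by
      intro t ht
      have := hgf t ht t ht
      rw [hg t ht] at this
      simpa using this.symm
    have hu := huniq R' hm (by
      intro t ht u hu s hs
      simp only [delta2]
      rw [hgf t ht s hs, hgf t ht u hu, hgf u hu s hs]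
      abel) hR'
    refine ⟨f' 0 - f 0, fun t ht => ?_⟩
    have e := hgf t ht 0 h0
    rw [hu t ht 0 h0] at e
    have e2 : f' t - f' 0 - (f t - f 0) = 0 := by
      have : f' t - f' 0 - (f t - f 0) = (f' t - f' 0 + (g t 0 - (f t - f 0))) - g t 0 := by abel
      rw [this, ← e, sub_self]
    have e3 : f' t - (f t + (f' 0 - f 0)) = 0 := by rw [← e2]; abel
    exact sub_eq_zero.1 e3
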